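/- arXiv:0807.4302 — 2 statements merged into one kernel-verified Lean document; each statement's English description precedes it below -/
import Mathlib

section
/- Let n ≥ 1, let R = ℚ[x_{ij} : 1 ≤ i,j ≤ n] be the polynomial ring in the entries of the generic n×n matrix M = (x_{ij}), and let f = det M ∈ R. For every b ∈ ℚ[s], b satisfies the Bernstein–Sato functional equation for the pair (f, 1) if and only if ∏_{i=1}^n (s+i) divides b in ℚ[s]; that is, the Bernstein–Sato polynomial of the generic determinant is b_f(s) = ∏_{i=1}^n (s+i). -/
open MvPolynomial Polynomial

/-- The iterated formal partial derivative `∂^α = ∏ᵢ ∂_{xᵢ}^{αᵢ}` applied to a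
multivariate polynomial (the partial derivatives pairwise commute, so the order
of the fold is immaterial). -/
noncomputable def pdIter {σ : Type*} [Fintype σ] (α : σ → ℕ)
    (p : MvPolynomial σ ℚ) : MvPolynomial σ ℚ :=
  Finset.univ.toList.foldl (fun q i => (⇑(MvPolynomial.pderiv i))^[α i] q) p

/-- `b ∈ ℚ[s]` satisfies the Bernstein–Sato functional equation for the pair
`(f, g)`: there are finitely many multi-indices `α` and polynomials
`p_α ∈ (ℚ[x])[s]` with `b(m)·g·f^m = Σ_α p_α(m)·∂^α(g·f^(m+1))` for all `m ∈ ℕ`. -/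
def SatisfiesBS {σ : Type*} [Fintype σ] (f g : MvPolynomial σ ℚ)
    (b : Polynomial ℚ) : Prop :=
  ∃ (A : Finset (σ → ℕ)) (p : (σ → ℕ) → Polynomial (MvPolynomial σ ℚ)),
    ∀ m : ℕ,
      MvPolynomial.C (Polynomial.eval (m : ℚ) b) * g * f ^ m =
        ∑ α ∈ A, Polynomial.eval ((m : ℕ) : MvPolynomial σ ℚ) (p α) *
          pdIter α (g * f ^ (m + 1))

section FischerPairing

variable {σ : Type*}

/-- The Fischer pairing `⟨u, v⟩ = (u(∂) v)(0)`, for which the monomials are orthogonal and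
`⟨x^γ, x^γ⟩ = γ!`. -/
noncomputable def fischer : MvPolynomial σ ℚ →ₗ[ℚ] MvPolynomial σ ℚ →ₗ[ℚ] ℚ :=
  (MvPolynomial.basisMonomials σ ℚ).constr ℚ fun γ =>
    (γ.prod fun _ k => (k.factorial : ℚ)) • MvPolynomial.lcoeff ℚ γ

theorem fischer_monomial_one (γ : σ →₀ ℕ) (v : MvPolynomial σ ℚ) :
    fischer (MvPolynomial.monomial γ 1) v =
      (γ.prod fun _ k => (k.factorial : ℚ)) * MvPolynomial.coeff γ v := by
  have := (MvPolynomial.basisMonomials σ ℚ).constr_basis ℚ (fun γ =>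
    (γ.prod fun _ k => (k.factorial : ℚ)) • MvPolynomial.lcoeff ℚ γ) γ
  rw [MvPolynomial.coe_basisMonomials] at this
  simp [fischer, this]

theorem fischer_monomial (γ : σ →₀ ℕ) (a : ℚ) (v : MvPolynomial σ ℚ) :
    fischer (MvPolynomial.monomial γ a) v =
      a * ((γ.prod fun _ k => (k.factorial : ℚ)) * MvPolynomial.coeff γ v) := by
  rw [← fischer_monomial_one, ← smul_eq_mul, ← LinearMap.smul_apply, ← map_smul,
    MvPolynomial.smul_monomial, smul_eq_mul, mul_one]

theorem fischer_comm (u v : MvPolynomial σ ℚ) : fischer u v = fischer v u := by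
  classical
  induction u using MvPolynomial.induction_on' with
  | add p q hp hq => simp [hp, hq]
  | monomial γ a =>
    induction v using MvPolynomial.induction_on' with
    | add p q hp hq => simp only [map_add, LinearMap.add_apply, hp, hq]
    | monomial δ c =>
      rw [fischer_monomial, fischer_monomial, MvPolynomial.coeff_monomial,
        MvPolynomial.coeff_monomial]
      by_cases h : γ = δ
      · subst h; simp; ring
      · simp [h, Ne.symm h]

theorem fischer_left_injective {v w : MvPolynomial σ ℚ}
    (h : ∀ u, fischer u v = fischer u w) : v = w := by
  ext γ
  have := h (MvPolynomial.monomial γ 1)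
  rw [fischer_monomial_one, fischer_monomial_one] at this
  refine mul_left_cancel₀ ?_ this
  exact Finset.prod_ne_zero_iff.2 fun i _ => Nat.cast_ne_zero.2 (Nat.factorial_ne_zero _)

theorem fischer_X_mul (i : σ) (u v : MvPolynomial σ ℚ) :
    fischer (MvPolynomial.X i * u) v = fischer u (pderiv i v) := by
  classical
  induction u using MvPolynomial.induction_on' with
  | add p q hp hq => simp [mul_add, hp, hq]
  | monomial γ a =>
    have hX : (MvPolynomial.X i * MvPolynomial.monomial γ a : MvPolynomial σ ℚ) =
        MvPolynomial.monomial (γ + Finsupp.single i 1) a := by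
      rw [MvPolynomial.X, MvPolynomial.monomial_mul, one_mul, add_comm]
    have hfac : ((γ + Finsupp.single i 1).prod fun _ k => (k.factorial : ℚ)) =
        (γ.prod fun _ k => (k.factorial : ℚ)) * (γ i + 1) := by
      set s := insert i γ.support
      have h0 : ∀ j ∈ s, ((Nat.factorial 0 : ℕ) : ℚ) = 1 := by simp
      rw [Finsupp.prod_of_support_subset (s := s) _ (Finsupp.support_add.trans ?_) _ h0,
        Finsupp.prod_of_support_subset γ (Finset.subset_insert _ _) _ h0,
        ← Finset.mul_prod_erase s _ (Finset.mem_insert_self _ _),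
        ← Finset.mul_prod_erase s (fun j => ((γ j).factorial : ℚ)) (Finset.mem_insert_self _ _)]
      · rw [Finset.prod_congr rfl (g := fun j => ((γ j).factorial : ℚ))]
        · simp [Nat.factorial_succ]; ring
        · intro j hj
          simp [Finsupp.single_eq_of_ne (Finset.ne_of_mem_erase hj)]
      · intro j hj
        rcases Finset.mem_union.1 hj with h | h
        · exact Finset.mem_insert_of_mem h
        · rw [Finset.mem_singleton.1 (Finsupp.support_single_subset h)]
          exact Finset.mem_insert_self _ _
    rw [hX, fischer_monomial, fischer_monomial, MvPolynomial.coeff_pderiv, hfac]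
    ring

theorem fischer_prod_X_pow_mul [Fintype σ] (α : σ → ℕ) (u v : MvPolynomial σ ℚ) :
    fischer ((∏ i, MvPolynomial.X i ^ α i) * u) v = fischer u (pdIter α v) := by
  have hpow (i : σ) (k : ℕ) (u v : MvPolynomial σ ℚ) :
      fischer (MvPolynomial.X i ^ k * u) v = fischer u ((⇑(pderiv i))^[k] v) := by
    induction k generalizing v with
    | zero => simp
    | succ k ih => rw [pow_succ', mul_assoc, fischer_X_mul, ih, Function.iterate_succ_apply]
  rw [pdIter, ← Finset.prod_map_toList]
  generalize (Finset.univ : Finset σ).toList = l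
  induction l generalizing v with
  | nil => simp
  | cons i l ih => rw [List.map_cons, List.prod_cons, mul_assoc, hpow, ih, List.foldl_cons]

end FischerPairing

section ReplaceRows

open scoped Matrix

variable {ι R : Type*} [Fintype ι] [DecidableEq ι] [CommRing R] {k : ℕ}

theorem Function.extend_comp_succAbove {α β : Type*} [DecidableEq α] {a : Fin (k + 1) → α}
    (ha : a.Injective) (i : Fin (k + 1)) (v : Fin (k + 1) → β) (x : α → β) :
    Function.update (Function.extend (a ∘ i.succAbove) (v ∘ Fin.succ) x) (a i) (v 0) =
      Function.extend (a ∘ i.cycleRange.symm) v x := by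
  have hb : (a ∘ i.cycleRange.symm).Injective := ha.comp i.cycleRange.symm.injective
  have ha' : (a ∘ i.succAbove).Injective := ha.comp Fin.succAbove_right_injective
  funext r
  by_cases hr : ∃ j, (a ∘ i.cycleRange.symm) j = r
  · obtain ⟨j, rfl⟩ := hr
    rw [hb.extend_apply]
    induction j using Fin.cases with
    | zero => simp [Fin.cycleRange_symm_zero]
    | succ j =>
      rw [Function.comp_apply, Fin.cycleRange_symm_succ,
        Function.update_of_ne (fun h => Fin.succAbove_ne i j (ha h))]
      exact ha'.extend_apply _ _ j
  · have hr' : ∀ l, a l ≠ r := fun l hl => hr ⟨i.cycleRange l, by simpa using hl⟩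
    rw [Function.extend_apply' _ _ _ hr, Function.update_of_ne (fun h => hr' i h.symm),
      Function.extend_apply']
    rintro ⟨j, hj⟩
    exact hr' _ hj

theorem Matrix.det_extend_comp_perm {a : Fin k → ι} (ha : a.Injective) (τ : Equiv.Perm (Fin k))
    (v : Fin k → ι → R) (x : ι → ι → R) :
    (Matrix.of (Function.extend (a ∘ τ) v x)).det =
      (Equiv.Perm.sign τ : ℤ) * (Matrix.of (Function.extend a v x)).det := by
  set π := τ⁻¹.viaFintypeEmbedding ⟨a, ha⟩ with hπ
  have hb : (a ∘ τ).Injective := ha.comp τ.injective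
  have h : Matrix.of (Function.extend (a ∘ τ) v x) =
      (Matrix.of (Function.extend a v x)).submatrix π id := by
    ext r c
    simp only [Matrix.of_apply, Matrix.submatrix_apply, id]
    by_cases hr : ∃ j, (a ∘ τ) j = r
    · obtain ⟨j, rfl⟩ := hr
      have : π ((a ∘ τ) j) = a j := by
        have := τ⁻¹.viaFintypeEmbedding_apply_image ⟨a, ha⟩ (τ j)
        simpa using this
      rw [hb.extend_apply, this, ha.extend_apply]
    · have hr' : ¬ ∃ j, a j = r := fun ⟨j, hj⟩ => hr ⟨τ.symm j, by simpa using hj⟩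
      have : π r = r :=
        Equiv.Perm.viaFintypeEmbedding_apply_notMem_range _ _ (by simpa using hr')
      rw [this, Function.extend_apply' _ _ _ hr, Function.extend_apply' _ _ _ hr']
  rw [h, Matrix.det_permute, hπ, Equiv.Perm.viaFintypeEmbedding_sign, Equiv.Perm.sign_inv]

theorem Matrix.det_updateRow_extend {a : Fin (k + 1) → ι} (ha : a.Injective) (i : Fin (k + 1))
    (v : Fin (k + 1) → ι → R) (x : ι → ι → R) :
    ((Matrix.of (Function.extend (a ∘ i.succAbove) (v ∘ Fin.succ) x)).updateRow (a i) (v 0)).det =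
      (-1) ^ (i : ℕ) * (Matrix.of (Function.extend a v x)).det := by
  have h := Matrix.det_extend_comp_perm ha i.cycleRange.symm v x
  rw [← Function.extend_comp_succAbove ha] at h
  rw [Equiv.Perm.sign_symm, Fin.sign_cycleRange] at h
  refine Eq.trans h ?_
  push_cast
  rfl

/-- Cramer expansion of the vector `f • e_q` along the rows of `x`, inserted in one of the replaced
rows. -/
theorem Matrix.sum_adjugate_mul_det_extend {a : Fin (k + 1) → ι} (ha : a.Injective) (q : ι)
    (v : Fin (k + 1) → ι → R) (hv : v 0 = Pi.single q 1) (x : ι → ι → R) :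
    ∑ i : Fin (k + 1), (-1) ^ (i : ℕ) * ((Matrix.of x).adjugate q (a i) *
        (Matrix.of (Function.extend (a ∘ i.succAbove) (v ∘ Fin.succ) x)).det) =
      (Matrix.of x).det * (Matrix.of (Function.extend a v x)).det := by
  set Z : Matrix ι ι R := Matrix.of (Function.extend a v x) with hZ
  have hZ' (w : ι → R) :
      Matrix.of (Function.extend a (Fin.cons w (v ∘ Fin.succ) : Fin (k + 1) → ι → R) x) =
        Z.updateRow (a 0) w := by
    have h1 := Function.extend_comp_succAbove ha 0
      (Fin.cons w (v ∘ Fin.succ) : Fin (k + 1) → ι → R) x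
    have h2 := Function.extend_comp_succAbove ha 0 v x
    have hid : a ∘ (Fin.cycleRange (0 : Fin (k + 1))).symm = a := by
      rw [Fin.cycleRange_zero]; rfl
    rw [hid] at h1 h2
    rw [← h1, hZ, ← h2]
    ext r c
    by_cases hr : r = a 0
    · subst hr; simp
    · rw [Matrix.updateRow_ne hr, Matrix.of_apply, Matrix.of_apply, Function.update_of_ne hr,
        Function.update_of_ne hr]
      rfl
  have hterm (i : Fin (k + 1)) : (-1) ^ (i : ℕ) *
      (Matrix.of (Function.extend (a ∘ i.succAbove) (v ∘ Fin.succ) x)).det =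
        (Z.updateRow (a 0) (x (a i))).det := by
    rw [← hZ']
    have h : ((Matrix.of (Function.extend (a ∘ i.succAbove) (v ∘ Fin.succ) x)).updateRow (a i)
        (x (a i))).det = _ := Matrix.det_updateRow_extend ha i
      (Fin.cons (x (a i)) (v ∘ Fin.succ) : Fin (k + 1) → ι → R) x
    have hx : Function.extend (a ∘ i.succAbove) (v ∘ Fin.succ) x (a i) = x (a i) :=
      Function.extend_apply' _ _ _ fun ⟨j, hj⟩ => Fin.succAbove_ne i j (ha hj)
    have hself : (Matrix.of (Function.extend (a ∘ i.succAbove) (v ∘ Fin.succ) x)).updateRow (a i)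
        (x (a i)) = Matrix.of (Function.extend (a ∘ i.succAbove) (v ∘ Fin.succ) x) := by
      conv_lhs => rw [← hx]
      exact Matrix.updateRow_eq_self _ _
    rw [hself] at h
    rw [h, ← mul_assoc, ← mul_pow, neg_one_mul, neg_neg, one_pow, one_mul]
  have hzero (l : ι) (hl : l ∉ Set.range a) : (Z.updateRow (a 0) (x l)).det = 0 := by
    have hne : l ≠ a 0 := fun h => hl ⟨0, h.symm⟩
    refine Matrix.det_zero_of_row_eq hne ?_
    rw [Matrix.updateRow_self, Matrix.updateRow_ne hne]
    exact Function.extend_apply' _ _ _ hl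
  calc _ = ∑ i, (Matrix.of x).adjugate q (a i) * (Z.updateRow (a 0) (x (a i))).det :=
        Finset.sum_congr rfl fun i _ => by rw [← hterm]; ring
    _ = ∑ l, (Matrix.of x).adjugate q l * (Z.updateRow (a 0) (x l)).det := by
        refine Finset.sum_of_injOn a ha.injOn (by simp) (fun l _ hl => ?_) (fun _ _ => rfl)
        rw [hzero l (by simpa using hl), mul_zero]
    _ = (Z.updateRow (a 0) ((Matrix.of x).adjugate q ᵥ* Matrix.of x)).det := by
        simp_rw [← Matrix.cramer_transpose_apply]
        have : (Matrix.of x).adjugate q ᵥ* Matrix.of x =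
            ∑ l, (Matrix.of x).adjugate q l • x l := by
          ext c
          simp [Matrix.vecMul, dotProduct]
        rw [this, map_sum, Finset.sum_apply]
        simp
    _ = _ := by
        have : (Matrix.of x).adjugate q ᵥ* Matrix.of x = (Matrix.of x).det • v 0 := by
          rw [← Matrix.mul_apply_eq_vecMul, Matrix.adjugate_mul, hv]
          ext j
          simp [Matrix.one_apply, Pi.single_apply, eq_comm]
        have h0 : v 0 = Z (a 0) := (ha.extend_apply v x 0).symm
        rw [this, Matrix.det_updateRow_smul, h0, Matrix.updateRow_eq_self]

end ReplaceRows

section Cayley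

theorem pderiv_X_row {ι : Type*} [DecidableEq ι] (i q j : ι) :
    pderiv (i, q) (MvPolynomial.X (i, j) : MvPolynomial (ι × ι) ℚ) =
      (Pi.single q 1 : ι → MvPolynomial (ι × ι) ℚ) j := by
  simp [pderiv_X, Pi.single_apply]

variable {ι : Type*} [Fintype ι] [DecidableEq ι]

theorem Derivation.map_det_eq_zero {S A : Type*} [CommRing S] [CommRing A] [Algebra S A]
    (D : Derivation S A A) (Y : Matrix ι ι A) (h : ∀ i j, D (Y i j) = 0) : D Y.det = 0 := by
  have hprod (s : Finset ι) (g : ι → A) (hg : ∀ i, D (g i) = 0) : D (∏ i ∈ s, g i) = 0 := by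
    induction s using Finset.induction_on with
    | empty => simp
    | insert i s hi ih => rw [Finset.prod_insert hi, D.leibniz, ih, hg]; simp
  rw [Matrix.det_apply, map_sum]
  refine Finset.sum_eq_zero fun σ _ => ?_
  rw [Units.smul_def, map_zsmul, hprod _ _ fun i => h _ _, smul_zero]

theorem Derivation.map_det_of_row {S A : Type*} [CommRing S] [CommRing A] [Algebra S A]
    (D : Derivation S A A) (Y : Matrix ι ι A) (r : ι) (h : ∀ i ≠ r, ∀ j, D (Y i j) = 0) :
    D Y.det = (Y.updateRow r fun j => D (Y r j)).det := by
  have hadj (j : ι) : D (Y.adjugate j r) = 0 := by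
    rw [Matrix.adjugate_apply]
    refine D.map_det_eq_zero _ fun i l => ?_
    by_cases hi : i = r
    · subst hi
      rw [Matrix.updateRow_self, Pi.single_apply]
      split_ifs <;> simp
    · rw [Matrix.updateRow_ne hi, h i hi]
  have hadj' (j : ι) (w : ι → A) : (Y.updateRow r w).adjugate j r = Y.adjugate j r := by
    simp [Matrix.adjugate_apply]
  rw [Matrix.det_eq_sum_mul_adjugate_row Y r, Matrix.det_eq_sum_mul_adjugate_row _ r, map_sum]
  refine Finset.sum_congr rfl fun j _ => ?_
  rw [D.leibniz, hadj, hadj', Matrix.updateRow_self]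
  simp [mul_comm]

variable (ι) in
/-- The determinant of the generic matrix. -/
noncomputable def genericDet : MvPolynomial (ι × ι) ℚ :=
  (Matrix.of fun i j : ι => (MvPolynomial.X (i, j) : MvPolynomial (ι × ι) ℚ)).det

/-- The determinant of the generic matrix with the rows `a j` replaced by the unit vectors
`e_(c j)`. -/
noncomputable def unitRowDet {k : ℕ} (a c : Fin k → ι) : MvPolynomial (ι × ι) ℚ :=
  (Matrix.of (Function.extend a (fun j => Pi.single (c j) 1)
    fun i j => (MvPolynomial.X (i, j) : MvPolynomial (ι × ι) ℚ))).det

theorem pderiv_genericDet (i q : ι) : pderiv (i, q) (genericDet ι) =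
    (Matrix.of fun i j : ι => (MvPolynomial.X (i, j) : MvPolynomial (ι × ι) ℚ)).adjugate q i := by
  rw [genericDet, Derivation.map_det_of_row _ _ i, Matrix.adjugate_apply]
  · simp only [Matrix.of_apply, pderiv_X_row]
  · intro l hl j
    exact pderiv_X_of_ne fun h => hl (congrArg Prod.fst h)

theorem pderiv_unitRowDet {k : ℕ} {a : Fin (k + 1) → ι} (ha : a.Injective) (c : Fin (k + 1) → ι)
    (i : Fin (k + 1)) :
    pderiv (a i, c 0) (unitRowDet (a ∘ i.succAbove) (c ∘ Fin.succ)) =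
      (-1) ^ (i : ℕ) * unitRowDet a c := by
  have hi : ¬ ∃ j, (a ∘ i.succAbove) j = a i :=
    fun ⟨j, hj⟩ => Fin.succAbove_ne i j (ha hj)
  rw [unitRowDet, Derivation.map_det_of_row _ _ (a i)]
  · simp only [Matrix.of_apply, Function.extend_apply' _ _ _ hi, pderiv_X_row]
    exact Matrix.det_updateRow_extend ha i (fun j => Pi.single (c j) 1) _
  · intro r hr j
    rw [Matrix.of_apply]
    by_cases h : ∃ j, (a ∘ i.succAbove) j = r
    · obtain ⟨l, rfl⟩ := h
      rw [(ha.comp Fin.succAbove_right_injective).extend_apply, Pi.single_apply]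
      split_ifs <;> simp
    · rw [Function.extend_apply' _ _ _ h]
      exact pderiv_X_of_ne fun h => hr (congrArg Prod.fst h)

theorem sum_pderiv_genericDet_pow_mul_unitRowDet {k : ℕ} {a : Fin (k + 1) → ι} (ha : a.Injective)
    (c : Fin (k + 1) → ι) (m : ℕ) :
    ∑ i : Fin (k + 1), (-1) ^ (i : ℕ) * pderiv (a i, c 0)
        (genericDet ι ^ m * unitRowDet (a ∘ i.succAbove) (c ∘ Fin.succ)) =
      ((m + 1 + k : ℕ) : MvPolynomial (ι × ι) ℚ) * (genericDet ι ^ m * unitRowDet a c) := by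
  have hsum : ∑ i : Fin (k + 1), (-1) ^ (i : ℕ) * (pderiv (a i, c 0) (genericDet ι) *
      unitRowDet (a ∘ i.succAbove) (c ∘ Fin.succ)) = genericDet ι * unitRowDet a c := by
    simp_rw [pderiv_genericDet]
    exact Matrix.sum_adjugate_mul_det_extend ha (c 0) (fun j => Pi.single (c j) 1) rfl _
  have hterm (i : Fin (k + 1)) : (-1) ^ (i : ℕ) * pderiv (a i, c 0)
        (genericDet ι ^ m * unitRowDet (a ∘ i.succAbove) (c ∘ Fin.succ)) =
      m * genericDet ι ^ (m - 1) * ((-1) ^ (i : ℕ) * (pderiv (a i, c 0) (genericDet ι) *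
        unitRowDet (a ∘ i.succAbove) (c ∘ Fin.succ))) + genericDet ι ^ m * unitRowDet a c := by
    have hsq : ((-1) ^ (i : ℕ) * (-1) ^ (i : ℕ) : MvPolynomial (ι × ι) ℚ) = 1 := by
      rw [← mul_pow]; simp
    rw [pderiv_mul, pderiv_pow, pderiv_unitRowDet ha]
    linear_combination genericDet ι ^ m * unitRowDet a c * hsq
  rw [Finset.sum_congr rfl fun i _ => hterm i, Finset.sum_add_distrib, ← Finset.mul_sum, hsum]
  rcases m with _ | m
  · simp [add_comm]
  · simp; ring

/-- Cayley's identity for the minors, in a form dual under the Fischer pairing. -/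
theorem fischer_minor_mul {k : ℕ} {a : Fin k → ι} (ha : a.Injective) (c : Fin k → ι) (m : ℕ)
    (u : MvPolynomial (ι × ι) ℚ) :
    fischer ((Matrix.of fun i j : Fin k =>
        (MvPolynomial.X (a i, c j) : MvPolynomial (ι × ι) ℚ)).det * u) (genericDet ι ^ (m + 1)) =
      (∏ i ∈ Finset.range k, ((m : ℚ) + 1 + i)) *
        fischer u (genericDet ι ^ m * unitRowDet a c) := by
  induction k generalizing u with
  | zero =>
    have : unitRowDet a c = genericDet ι := by
      rw [unitRowDet, genericDet]
      congr 2
      funext r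
      exact Function.extend_apply' _ _ _ fun ⟨j, _⟩ => j.elim0
    simp [this, pow_succ]
  | succ k ih =>
    have hminor (i : Fin (k + 1)) :
        ((Matrix.of fun i j : Fin (k + 1) => (MvPolynomial.X (a i, c j) :
          MvPolynomial (ι × ι) ℚ)).submatrix i.succAbove Fin.succ) =
        Matrix.of fun l j : Fin k => (MvPolynomial.X ((a ∘ i.succAbove) l, (c ∘ Fin.succ) j)) := rfl
    have hsign (i : ℕ) (p : MvPolynomial (ι × ι) ℚ) : (-1) ^ i * p = ((-1) ^ i : ℚ) • p := by
      simp [MvPolynomial.smul_eq_C_mul]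
    have hterm (i : Fin (k + 1)) :
        fischer ((-1) ^ (i : ℕ) * MvPolynomial.X (a i, c 0) *
          (Matrix.of fun l j : Fin k =>
            (MvPolynomial.X ((a ∘ i.succAbove) l, (c ∘ Fin.succ) j))).det * u)
          (genericDet ι ^ (m + 1)) =
        (∏ i ∈ Finset.range k, ((m : ℚ) + 1 + i)) * fischer u ((-1) ^ (i : ℕ) *
          pderiv (a i, c 0)
            (genericDet ι ^ m * unitRowDet (a ∘ i.succAbove) (c ∘ Fin.succ))) := by
      rw [mul_assoc, mul_assoc, mul_left_comm (MvPolynomial.X _), hsign, hsign, map_smul, map_smul,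
        LinearMap.smul_apply, ih (ha.comp Fin.succAbove_right_injective), fischer_X_mul]
      simp only [smul_eq_mul]
      ring
    rw [Matrix.det_succ_column_zero, Finset.sum_mul, map_sum, LinearMap.sum_apply]
    simp only [hminor, Matrix.of_apply]
    rw [Finset.sum_congr rfl fun i _ => hterm i, ← Finset.mul_sum, ← map_sum,
      sum_pderiv_genericDet_pow_mul_unitRowDet ha, ← nsmul_eq_mul, map_nsmul, nsmul_eq_mul,
      Finset.prod_range_succ]
    push_cast
    ring

variable {n : ℕ}

theorem fischer_genericDet_mul (m : ℕ) (u : MvPolynomial (Fin n × Fin n) ℚ) :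
    fischer (genericDet (Fin n) * u) (genericDet (Fin n) ^ (m + 1)) =
      (∏ i ∈ Finset.range n, ((m : ℚ) + (i + 1))) * fischer u (genericDet (Fin n) ^ m) := by
  have hunit : unitRowDet (id : Fin n → Fin n) id = 1 := by
    rw [unitRowDet]
    refine (congrArg Matrix.det (Matrix.ext fun r j => ?_)).trans (Matrix.det_one (n := Fin n))
    have := (Function.injective_id (α := Fin n)).extend_apply
      (fun j => (Pi.single j 1 : Fin n → MvPolynomial (Fin n × Fin n) ℚ))
      (fun i j => MvPolynomial.X (i, j)) r
    rw [Matrix.of_apply]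
    refine (congrFun this j).trans ?_
    rw [Matrix.one_eq_pi_single]
  have h := fischer_minor_mul (Function.injective_id (α := Fin n)) id m u
  rw [hunit, mul_one] at h
  refine h.trans ?_
  congr 1
  exact Finset.prod_congr rfl fun i _ => by ring

theorem cayley_identity (m : ℕ) :
    ∑ π : Equiv.Perm (Fin n), (((Equiv.Perm.sign π : ℤ) : ℚ)) •
        pdIter (fun p : Fin n × Fin n => if π p.2 = p.1 then 1 else 0)
          (genericDet (Fin n) ^ (m + 1)) =
      (∏ i ∈ Finset.range n, ((m : ℚ) + (i + 1))) • genericDet (Fin n) ^ m := by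
  refine fischer_left_injective fun u => ?_
  rw [map_smul, smul_eq_mul, ← fischer_genericDet_mul]
  have hdet : genericDet (Fin n) = ∑ π : Equiv.Perm (Fin n), (((Equiv.Perm.sign π : ℤ) : ℚ)) •
      ∏ p : Fin n × Fin n, MvPolynomial.X p ^ (if π p.2 = p.1 then 1 else 0) := by
    rw [genericDet, Matrix.det_apply']
    refine Finset.sum_congr rfl fun π _ => ?_
    rw [Fintype.prod_prod_type_right, MvPolynomial.smul_eq_C_mul]
    simp [Finset.prod_ite_eq, pow_ite]
  conv_rhs => rw [hdet, Finset.sum_mul, map_sum, LinearMap.sum_apply]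
  rw [← hdet, map_sum]
  refine Finset.sum_congr rfl fun π _ => ?_
  rw [smul_mul_assoc, map_smul, map_smul, LinearMap.smul_apply, fischer_prod_X_pow_mul]

end Cayley

section Minimality

variable {n : ℕ}

variable (n) in
/-- The polynomial `(s + 1) ⋯ (s + n)`. -/
noncomputable def cayleyPoly : Polynomial ℚ :=
  ∏ i ∈ Finset.range n, (Polynomial.X + Polynomial.C ((i : ℚ) + 1))

theorem eval_cayleyPoly (m : ℕ) :
    (cayleyPoly n).eval (m : ℚ) = ∏ i ∈ Finset.range n, ((m : ℚ) + (i + 1)) := by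
  simp [cayleyPoly, Polynomial.eval_prod]

theorem eval_cayleyPoly_ne_zero (m : ℕ) : (cayleyPoly n).eval (m : ℚ) ≠ 0 := by
  rw [eval_cayleyPoly]
  exact Finset.prod_ne_zero_iff.2 fun i _ => by positivity

variable (n) in
/-- The Fischer norm of `det ^ j`. -/
noncomputable def detNorm (j : ℕ) : ℚ := ∏ l ∈ Finset.range j, (cayleyPoly n).eval (l : ℚ)

theorem detNorm_ne_zero (j : ℕ) : detNorm n j ≠ 0 :=
  Finset.prod_ne_zero_iff.2 fun l _ => eval_cayleyPoly_ne_zero l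

theorem detNorm_succ (j : ℕ) : detNorm n (j + 1) = detNorm n j * (cayleyPoly n).eval (j : ℚ) :=
  Finset.prod_range_succ _ _

theorem fischer_mul_genericDet_pow (u : MvPolynomial (Fin n × Fin n) ℚ) (j t : ℕ) :
    detNorm n j * fischer (u * genericDet (Fin n) ^ t) (genericDet (Fin n) ^ (j + t)) =
      detNorm n (j + t) * fischer u (genericDet (Fin n) ^ j) := by
  induction t with
  | zero => simp
  | succ t ih =>
    rw [pow_succ' _ t, mul_left_comm, ← add_assoc, fischer_genericDet_mul, ← eval_cayleyPoly,
      detNorm_succ, mul_left_comm, ih]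
    ring

theorem fischer_genericDet_pow_self (m : ℕ) :
    fischer (genericDet (Fin n) ^ m) (genericDet (Fin n) ^ m) = detNorm n m := by
  have h := fischer_mul_genericDet_pow (1 : MvPolynomial (Fin n × Fin n) ℚ) 0 m
  have h1 : fischer (1 : MvPolynomial (Fin n × Fin n) ℚ) 1 = 1 := by
    have := fischer_monomial_one (0 : Fin n × Fin n →₀ ℕ) 1
    simpa using this
  simpa [detNorm, h1] using h

/-- Applying a linear functional to a polynomial family gives a polynomial function. -/
theorem exists_eval_eq_linearMap {A : Type*} [CommRing A] [Algebra ℚ A] (L : A →ₗ[ℚ] ℚ)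
    (H : Polynomial A) : ∃ Q : Polynomial ℚ, ∀ t : ℕ, Q.eval (t : ℚ) = L (H.eval (t : A)) := by
  induction H using Polynomial.induction_on' with
  | add p q hp hq =>
    obtain ⟨P, hP⟩ := hp
    obtain ⟨Q, hQ⟩ := hq
    exact ⟨P + Q, fun t => by simp [hP, hQ]⟩
  | monomial k r =>
    refine ⟨Polynomial.C (L r) * Polynomial.X ^ k, fun t => ?_⟩
    have : r * (t : A) ^ k = ((t : ℚ) ^ k) • r := by
      rw [Algebra.smul_def]
      simp [mul_comm]
    rw [Polynomial.eval_monomial, this, map_smul, smul_eq_mul, Polynomial.eval_mul,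
      Polynomial.eval_C, Polynomial.eval_pow, Polynomial.eval_X, mul_comm]

/-- `F m = H(m - k) f ^ (m - k)` for `m ≥ k`, with `H` polynomial in its argument. -/
def IsPolyMulPow {A : Type*} [CommRing A] (f : A) (F : ℕ → A) : Prop :=
  ∃ (k : ℕ) (H : Polynomial A), ∀ t : ℕ, F (t + k) = H.eval (t : A) * f ^ t

theorem IsPolyMulPow.map_derivation {A : Type*} [CommRing A] [Algebra ℚ A] {f : A} {F : ℕ → A}
    (hF : IsPolyMulPow f F) (D : Derivation ℚ A A) : IsPolyMulPow f fun m => D (F m) := by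
  obtain ⟨k, H, hH⟩ := hF
  have hD : ∃ G : Polynomial A, ∀ t : ℕ, G.eval (t : A) = D (H.eval (t : A)) := by
    clear hH
    induction H using Polynomial.induction_on' with
    | add p q hp hq =>
      obtain ⟨P, hP⟩ := hp
      obtain ⟨Q, hQ⟩ := hq
      exact ⟨P + Q, fun t => by simp [hP, hQ]⟩
    | monomial j r =>
      refine ⟨Polynomial.monomial j (D r), fun t => ?_⟩
      rw [Polynomial.eval_monomial, Polynomial.eval_monomial, ← Nat.cast_pow, D.leibniz,
        D.map_natCast]
      simp [mul_comm]
  obtain ⟨G, hG⟩ := hD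
  refine ⟨k + 1, G.comp (Polynomial.X + 1) * Polynomial.C f +
    H.comp (Polynomial.X + 1) * (Polynomial.X + 1) * Polynomial.C (D f), fun t => ?_⟩
  have hg := hG (t + 1)
  have hh := hH (t + 1)
  rw [show t + (k + 1) = t + 1 + k by ring]
  simp only [hh, D.leibniz, D.leibniz_pow, ← hg]
  simp
  ring

theorem IsPolyMulPow.pdIter {σ : Type*} [Fintype σ] {f : MvPolynomial σ ℚ}
    {F : ℕ → MvPolynomial σ ℚ} (hF : IsPolyMulPow f F) (γ : σ → ℕ) :
    IsPolyMulPow f fun m => _root_.pdIter γ (F m) := by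
  have hiter (i : σ) (k : ℕ) {F : ℕ → MvPolynomial σ ℚ} (hF : IsPolyMulPow f F) :
      IsPolyMulPow f fun m => (⇑(pderiv i))^[k] (F m) := by
    induction k generalizing F with
    | zero => exact hF
    | succ k ih =>
      simp only [Function.iterate_succ_apply]
      exact ih (hF.map_derivation (pderiv i))
  unfold _root_.pdIter
  generalize (Finset.univ : Finset σ).toList = l
  induction l generalizing F with
  | nil => exact hF
  | cons i l ih => exact ih (hiter i _ hF)

variable (n) in
/-- Functions of the form `h m = Q m * ‖det ^ (m + 1)‖²` for large `m`, with `Q` polynomial. -/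
def IsPolyMulNorm (h : ℕ → ℚ) : Prop :=
  ∃ (Q : Polynomial ℚ) (K : ℕ), ∀ m ≥ K, h m = Q.eval (m : ℚ) * detNorm n (m + 1)

theorem IsPolyMulNorm.add {g h : ℕ → ℚ} (hg : IsPolyMulNorm n g) (hh : IsPolyMulNorm n h) :
    IsPolyMulNorm n fun m => g m + h m := by
  obtain ⟨P, K, hP⟩ := hg
  obtain ⟨Q, L, hQ⟩ := hh
  refine ⟨P + Q, max K L, fun m hm => ?_⟩
  beta_reduce
  rw [hP m ((le_max_left _ _).trans hm), hQ m ((le_max_right _ _).trans hm), Polynomial.eval_add,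
    add_mul]

theorem IsPolyMulNorm.sum {ι : Type*} (s : Finset ι) {h : ι → ℕ → ℚ}
    (hh : ∀ i ∈ s, IsPolyMulNorm n (h i)) : IsPolyMulNorm n fun m => ∑ i ∈ s, h i m := by
  classical
  induction s using Finset.induction_on with
  | empty => exact ⟨0, 0, by simp⟩
  | insert i s hi ih =>
    simp only [Finset.sum_insert hi]
    exact (hh i (Finset.mem_insert_self _ _)).add
      (ih fun j hj => hh j (Finset.mem_insert_of_mem hj))

theorem IsPolyMulNorm.eval_mul {h : ℕ → ℚ} (hh : IsPolyMulNorm n h) (P : Polynomial ℚ) :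
    IsPolyMulNorm n fun m => P.eval (m : ℚ) * h m := by
  obtain ⟨Q, K, hQ⟩ := hh
  exact ⟨P * Q, K, fun m hm => by beta_reduce; rw [hQ m hm, Polynomial.eval_mul, mul_assoc]⟩

theorem isPolyMulNorm_fischer_pdIter (γ α : Fin n × Fin n → ℕ) :
    IsPolyMulNorm n fun m => fischer (pdIter γ (genericDet (Fin n) ^ m))
      (pdIter α (genericDet (Fin n) ^ (m + 1))) := by
  have hF : IsPolyMulPow (genericDet (Fin n)) fun m => genericDet (Fin n) ^ m :=
    ⟨0, 1, fun t => by simp⟩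
  obtain ⟨k, H, hH⟩ := hF.pdIter γ
  obtain ⟨Q, hQ⟩ := exists_eval_eq_linearMap
    ((fischer.flip (genericDet (Fin n) ^ (k + 1))).comp
      (LinearMap.mulLeft ℚ (∏ p, MvPolynomial.X p ^ α p))) H
  refine ⟨Polynomial.C (detNorm n (k + 1))⁻¹ * Q.comp (Polynomial.X - Polynomial.C (k : ℚ)), k,
    fun m hm => ?_⟩
  obtain ⟨t, rfl⟩ := Nat.exists_eq_add_of_le' hm
  have h := fischer_mul_genericDet_pow ((∏ p, MvPolynomial.X p ^ α p) * H.eval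
    (t : MvPolynomial (Fin n × Fin n) ℚ)) (k + 1) t
  have hQt := hQ t
  simp only [LinearMap.comp_apply, LinearMap.flip_apply, LinearMap.mulLeft_apply] at hQt
  rw [← hQt] at h
  simp only [hH]
  rw [← fischer_prod_X_pow_mul, ← mul_assoc, show t + k + 1 = k + 1 + t by ring]
  have hne := detNorm_ne_zero (n := n) (k + 1)
  simp only [Polynomial.eval_mul, Polynomial.eval_C, Polynomial.eval_comp, Polynomial.eval_sub,
    Polynomial.eval_X, Nat.cast_add, add_sub_cancel_right]
  field_simp
  linear_combination h

theorem isPolyMulNorm_fischer_eval_mul_pdIter (p : Polynomial (MvPolynomial (Fin n × Fin n) ℚ))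
    (α : Fin n × Fin n → ℕ) :
    IsPolyMulNorm n fun m => fischer (genericDet (Fin n) ^ m)
      (p.eval (m : MvPolynomial (Fin n × Fin n) ℚ) *
        pdIter α (genericDet (Fin n) ^ (m + 1))) := by
  induction p using Polynomial.induction_on' with
  | add p q hp hq =>
    simp only [Polynomial.eval_add, add_mul, map_add]
    exact hp.add hq
  | monomial k r =>
    induction r using MvPolynomial.induction_on' with
    | add p q hp hq =>
      simp only [map_add, Polynomial.eval_add, add_mul]
      exact hp.add hq
    | monomial γ a =>
      have h := (isPolyMulNorm_fischer_pdIter (⇑γ) α).eval_mul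
        (Polynomial.C a * Polynomial.X ^ k)
      convert h using 2 with m
      have hm : (Polynomial.monomial k (MvPolynomial.monomial γ a)).eval
          (m : MvPolynomial (Fin n × Fin n) ℚ) =
          (a * (m : ℚ) ^ k) • ∏ p, MvPolynomial.X p ^ γ p := by
        rw [Polynomial.eval_monomial, MvPolynomial.monomial_eq, Finsupp.prod_fintype _ _ (by simp),
          MvPolynomial.smul_eq_C_mul]
        simp
        ring
      rw [hm, smul_mul_assoc, map_smul, fischer_comm, fischer_prod_X_pow_mul, fischer_comm]
      simp

theorem cayleyPoly_dvd_of_satisfiesBS {b : Polynomial ℚ}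
    (hb : SatisfiesBS (genericDet (Fin n)) 1 b) : cayleyPoly n ∣ b := by
  obtain ⟨A, p, h⟩ := hb
  obtain ⟨Q, K, hQ⟩ := IsPolyMulNorm.sum A fun α _ => isPolyMulNorm_fischer_eval_mul_pdIter (p α) α
  refine ⟨Q, Polynomial.eq_of_infinite_eval_eq _ _ ?_⟩
  refine Set.Infinite.mono ?_ ((Set.Ici_infinite K).image (Nat.cast_injective (R := ℚ)).injOn)
  rintro _ ⟨m, hm, rfl⟩
  have h1 := congrArg (fischer (genericDet (Fin n) ^ m)) (h m)
  simp only [one_mul, mul_one, map_sum] at h1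
  replace h1 := h1.trans (hQ m hm)
  rw [← MvPolynomial.smul_eq_C_mul, map_smul, fischer_genericDet_pow_self, detNorm_succ,
    smul_eq_mul] at h1
  refine mul_right_cancel₀ (detNorm_ne_zero (n := n) m) ?_
  rw [h1, Polynomial.eval_mul]
  ring

theorem satisfiesBS_of_cayleyPoly_dvd {b : Polynomial ℚ} (hb : cayleyPoly n ∣ b) :
    SatisfiesBS (genericDet (Fin n)) 1 b := by
  classical
  obtain ⟨Q, rfl⟩ := hb
  set e : Equiv.Perm (Fin n) → (Fin n × Fin n → ℕ) :=
    fun π p => if π p.2 = p.1 then 1 else 0 with he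
  refine ⟨Finset.univ.image e, fun α => Q.map MvPolynomial.C * Polynomial.C (MvPolynomial.C
    (∑ π with e π = α, ((Equiv.Perm.sign π : ℤ) : ℚ))), fun m => ?_⟩
  have hQ : (Q.map (MvPolynomial.C (σ := Fin n × Fin n))).eval
      (m : MvPolynomial (Fin n × Fin n) ℚ) = MvPolynomial.C (Q.eval (m : ℚ)) := by
    rw [← Polynomial.eval₂_hom, ← Polynomial.eval_map]
    simp
  have hterm (α : Fin n × Fin n → ℕ) : (Q.map MvPolynomial.C * Polynomial.C (MvPolynomial.C
        (∑ π with e π = α, ((Equiv.Perm.sign π : ℤ) : ℚ)))).eval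
          (m : MvPolynomial (Fin n × Fin n) ℚ) * pdIter α (1 * genericDet (Fin n) ^ (m + 1)) =
      MvPolynomial.C (Q.eval (m : ℚ)) * ∑ π with e π = α,
        (((Equiv.Perm.sign π : ℤ) : ℚ)) • pdIter (e π) (genericDet (Fin n) ^ (m + 1)) := by
    rw [Polynomial.eval_mul, hQ, Polynomial.eval_C, one_mul, mul_assoc,
      ← MvPolynomial.smul_eq_C_mul _ (∑ π with e π = α, ((Equiv.Perm.sign π : ℤ) : ℚ)),
      Finset.sum_smul]
    congr 1
    exact Finset.sum_congr rfl fun π hπ => by rw [(Finset.mem_filter.1 hπ).2]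
  rw [Finset.sum_congr rfl fun α _ => hterm α, ← Finset.mul_sum,
    Finset.sum_fiberwise_of_maps_to fun π _ => Finset.mem_image_of_mem e (Finset.mem_univ π),
    cayley_identity, ← eval_cayleyPoly, MvPolynomial.smul_eq_C_mul, Polynomial.eval_mul, map_mul]
  ring

end Minimality

theorem bernsteinSato_genericDeterminant (n : ℕ) (hn : 1 ≤ n) :
    ∀ b : Polynomial ℚ,
      SatisfiesBS
          ((Matrix.of fun i j : Fin n =>
              (X (i, j) : MvPolynomial (Fin n × Fin n) ℚ)).det)
          1 b ↔
        (∏ i ∈ Finset.range n,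
            (Polynomial.X + Polynomial.C ((i : ℚ) + 1))) ∣ b :=
  fun _ => ⟨cayleyPoly_dvd_of_satisfiesBS, satisfiesBS_of_cayleyPoly_dvd⟩
end

section
/- Let f = x² + y³ and g = x in ℚ[x,y]. For every b ∈ ℚ[s], b satisfies the Bernstein–Sato functional equation for the pair (f, g) if and only if (s + 1)(s + 11/6)(s + 13/6) divides b in ℚ[s]; that is, b_{f,x}(s) = (s + 1)(s + 11/6)(s + 13/6). -/
open MvPolynomial Polynomial

section General

variable {σ : Type*}

/-- Formally, `u = Q(s) f^(s + 1 - k)`. -/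
def IsTwistedPower (f : MvPolynomial σ ℚ) (u : ℕ → MvPolynomial σ ℚ) (k : ℕ)
    (Q : Polynomial (MvPolynomial σ ℚ)) : Prop :=
  ∀ m : ℕ, u m * f ^ k = Q.eval (m : MvPolynomial σ ℚ) * f ^ (m + 1)

theorem exists_eval_eq_pderiv_eval (i : σ) (Q : Polynomial (MvPolynomial σ ℚ)) :
    ∃ Q' : Polynomial (MvPolynomial σ ℚ), ∀ c : ℚ,
      Q'.eval (MvPolynomial.C c) = pderiv i (Q.eval (MvPolynomial.C c)) := by
  induction Q using Polynomial.induction_on' with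
  | add p q hp hq =>
    obtain ⟨p', hp'⟩ := hp
    obtain ⟨q', hq'⟩ := hq
    exact ⟨p' + q', fun c => by simp [hp', hq']⟩
  | monomial n a =>
    refine ⟨Polynomial.monomial n (pderiv i a), fun c => ?_⟩
    rw [Polynomial.eval_monomial, Polynomial.eval_monomial, ← MvPolynomial.C_pow, mul_comm a,
      pderiv_C_mul, mul_comm]

theorem IsTwistedPower.map_pderiv {f : MvPolynomial σ ℚ} {u : ℕ → MvPolynomial σ ℚ} {k : ℕ}
    {Q Q' : Polynomial (MvPolynomial σ ℚ)} (h : IsTwistedPower f u k Q) {i : σ}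
    (hQ' : ∀ c : ℚ, Q'.eval (MvPolynomial.C c) = pderiv i (Q.eval (MvPolynomial.C c))) :
    IsTwistedPower f (fun m => pderiv i (u m)) (k + 1)
      (Polynomial.C f * Q' + (Polynomial.X + 1 - Polynomial.C (k : MvPolynomial σ ℚ)) *
        Polynomial.C (pderiv i f) * Q) := by
  intro m
  have hm : Q'.eval (m : MvPolynomial σ ℚ) = pderiv i (Q.eval (m : MvPolynomial σ ℚ)) := by
    simpa using hQ' m
  have hd := congrArg (pderiv i) (h m)
  rw [pderiv_mul, pderiv_mul, pderiv_pow, pderiv_pow, ← hm] at hd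
  have hk : (k : MvPolynomial σ ℚ) * f ^ (k - 1) * f = k * f ^ k := by
    cases k <;> simp [pow_succ, mul_assoc]
  simp only [Polynomial.eval_add, Polynomial.eval_mul, Polynomial.eval_C, Polynomial.eval_sub,
    Polynomial.eval_X, Polynomial.eval_one, Nat.add_sub_cancel, Nat.cast_add, Nat.cast_one] at hd ⊢
  linear_combination f * hd - u m * pderiv i f * hk
    - k * pderiv i f * h m

theorem pdIter_induction [Fintype σ] {motive : (ℕ → MvPolynomial σ ℚ) → Prop}
    (hstep : ∀ u i, motive u → motive fun m => pderiv i (u m)) (α : σ → ℕ)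
    {u : ℕ → MvPolynomial σ ℚ} (hu : motive u) : motive fun m => pdIter α (u m) := by
  have hiter : ∀ (n : ℕ) (i : σ) (v : ℕ → MvPolynomial σ ℚ), motive v →
      motive fun m => (pderiv i)^[n] (v m) := by
    intro n i
    induction n with
    | zero => exact fun v hv => hv
    | succ n ih => exact fun v hv => ih _ (hstep v i hv)
  unfold pdIter
  generalize (Finset.univ : Finset σ).toList = l
  induction l generalizing u with
  | nil => exact hu
  | cons i l ih => exact ih (hiter _ i u hu)

/-- `N k` plays the role of `{q | q f^(c + 1 - k) ∈ N}` for a submodule `N` of the D-module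
generated by the powers of `f` with exponents in `c + ℤ`. -/
theorem SatisfiesBS.eval_eq_zero [Fintype σ] {f g : MvPolynomial σ ℚ} {b : Polynomial ℚ}
    (hb : SatisfiesBS f g b) (hf : f ≠ 0) (c : ℚ) (N : ℕ → Ideal (MvPolynomial σ ℚ))
    (hg : g ∈ N 0) (hmul : ∀ k, ∀ q ∈ N k, f * q ∈ N (k + 1))
    (hder : ∀ k i, ∀ q ∈ N k,
      f * pderiv i q + MvPolynomial.C (c + 1 - k) * pderiv i f * q ∈ N (k + 1))
    (hne : ∀ k, g * f ^ k ∉ N (k + 1)) : b.eval c = 0 := by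
  obtain ⟨A, p, hp⟩ := hb
  have key : ∀ α : σ → ℕ, ∃ k Q, IsTwistedPower f (fun m => pdIter α (g * f ^ (m + 1))) k Q ∧
      Q.eval (MvPolynomial.C c) ∈ N k := by
    intro α
    refine pdIter_induction (motive := fun u => ∃ k Q, IsTwistedPower f u k Q ∧
      Q.eval (MvPolynomial.C c) ∈ N k) ?_ α (u := fun m => g * f ^ (m + 1))
      ⟨0, Polynomial.C g, fun m => by simp, by simpa⟩
    rintro u i ⟨k, Q, hu, hQ⟩
    obtain ⟨Q', hQ'⟩ := exists_eval_eq_pderiv_eval i Q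
    refine ⟨k + 1, _, hu.map_pderiv hQ', ?_⟩
    simpa [hQ'] using hder k i _ hQ
  choose k Q hQ hN using key
  obtain ⟨K, hkK⟩ : ∃ K, ∀ α ∈ A, k α ≤ K := ⟨A.sup k, fun _ => Finset.le_sup⟩
  have hpoly : b.map MvPolynomial.C * Polynomial.C (g * f ^ K) =
      ∑ α ∈ A, p α * Polynomial.C (f ^ (K + 1 - k α)) * Q α := by
    refine Polynomial.eq_of_infinite_eval_eq _ _
      ((Set.infinite_range_of_injective (Nat.cast_injective (R := MvPolynomial σ ℚ))).mono ?_)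
    rintro _ ⟨m, rfl⟩
    have hbm : (b.map MvPolynomial.C).eval (m : MvPolynomial σ ℚ) =
        MvPolynomial.C (b.eval (m : ℚ)) := by
      have := Polynomial.eval_map_apply (f := (MvPolynomial.C : ℚ →+* MvPolynomial σ ℚ))
        (p := b) (m : ℚ)
      rwa [map_natCast] at this
    refine mul_right_cancel₀ (pow_ne_zero (m + 1) hf) ?_
    simp only [Polynomial.eval_mul, Polynomial.eval_C, Polynomial.eval_finsetSum, hbm,
      Finset.sum_mul]
    calc _ = MvPolynomial.C (b.eval (m : ℚ)) * g * f ^ m * f ^ (K + 1) := by ring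
      _ = _ := by
        rw [hp m, Finset.sum_mul]
        refine Finset.sum_congr rfl fun α hα => ?_
        have hK : f ^ (K + 1) = f ^ (K + 1 - k α) * f ^ k α := by
          rw [← pow_add, Nat.sub_add_cancel ((hkK α hα).trans (Nat.le_succ K))]
        rw [hK]
        linear_combination (p α).eval (m : MvPolynomial σ ℚ) * f ^ (K + 1 - k α) * hQ α m
  have hpow : ∀ n k, ∀ q ∈ N k, f ^ n * q ∈ N (k + n) := by
    intro n
    induction n with
    | zero => simp
    | succ n ih =>
      intro k q hq
      rw [pow_succ', mul_assoc]
      exact hmul _ _ (ih k q hq)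
  have hc := congrArg (Polynomial.eval (MvPolynomial.C c)) hpoly
  simp only [Polynomial.eval_mul, Polynomial.eval_C, Polynomial.eval_finsetSum,
    Polynomial.eval_map_apply] at hc
  have hmem : MvPolynomial.C (b.eval c) * (g * f ^ K) ∈ N (K + 1) := by
    rw [hc]
    refine Ideal.sum_mem _ fun α hα => ?_
    rw [mul_assoc]
    have hle : k α + (K + 1 - k α) = K + 1 :=
      Nat.add_sub_cancel' ((hkK α hα).trans (Nat.le_succ K))
    have hmemα := hpow (K + 1 - k α) _ _ (hN α)
    rw [hle] at hmemα
    exact Ideal.mul_mem_left _ _ hmemα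
  by_contra hbc
  refine hne K ?_
  have hinv := Ideal.mul_mem_left _ (MvPolynomial.C (b.eval c)⁻¹) hmem
  rwa [← mul_assoc, ← MvPolynomial.C_mul, inv_mul_cancel₀ hbc, MvPolynomial.C_1, one_mul] at hinv

/-- `L k` plays the role of `q ↦ ∫ q f^(c + 1 - k)`. -/
theorem SatisfiesBS.eval_eq_zero_of_functional [Fintype σ] {f g : MvPolynomial σ ℚ}
    {b : Polynomial ℚ} (hb : SatisfiesBS f g b) (hf : f ≠ 0) (c : ℚ)
    (L : ℕ → MvPolynomial σ ℚ →ₗ[ℚ] ℚ) (hg : ∀ p, L 0 (p * g) = 0)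
    (hmul : ∀ k q, L (k + 1) (f * q) = L k q)
    (hder : ∀ k i q,
      L (k + 1) (f * pderiv i q + MvPolynomial.C (c + 1 - k) * pderiv i f * q) = 0)
    (h : MvPolynomial σ ℚ) (hne : L 1 (h * g) ≠ 0) : b.eval c = 0 := by
  let N : ℕ → Ideal (MvPolynomial σ ℚ) := fun k =>
    { carrier := {q | ∀ p, L k (p * q) = 0}
      add_mem' := fun ha hb p => by simp [mul_add, ha p, hb p]
      zero_mem' := fun p => by simp
      smul_mem' := fun r q hq p => by simpa [mul_assoc] using hq (p * r) }
  refine hb.eval_eq_zero hf c N hg ?_ ?_ ?_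
  · intro k q hq p
    rw [mul_left_comm, hmul]
    exact hq p
  · intro k i q hq p
    have h1 := hder k i (p * q)
    have h2 := (hmul k (pderiv i p * q)).trans (hq _)
    rw [pderiv_mul] at h1
    rw [← sub_eq_zero.mpr (h1.trans h2.symm), ← map_sub]
    congr 1
    ring
  · intro k hk
    have hpow : ∀ n q, L (n + 1) (q * f ^ n) = L 1 q := by
      intro n q
      induction n with
      | zero => simp
      | succ n ih => rw [← ih, pow_succ', mul_left_comm, hmul]
    refine hne ?_
    rw [← hpow k, mul_assoc]
    exact hk h

theorem SatisfiesBS.eval_neg_one_eq_zero [Fintype σ] {f g : MvPolynomial σ ℚ}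
    {b : Polynomial ℚ} (hb : SatisfiesBS f g b) (hf : f ≠ 0) (hfg : ¬ f ∣ g) :
    b.eval (-1) = 0 := by
  refine hb.eval_eq_zero hf (-1) (fun k => Ideal.span {f ^ k}) (by simp) ?_ ?_ ?_
  · intro k q hq
    rw [Ideal.mem_span_singleton] at hq ⊢
    rw [pow_succ']
    exact mul_dvd_mul_left f hq
  · intro k i q hq
    rw [Ideal.mem_span_singleton] at hq ⊢
    obtain ⟨r, rfl⟩ := hq
    have hk : (k : MvPolynomial σ ℚ) * f ^ (k - 1) * f = k * f ^ k := by
      cases k <;> simp [pow_succ, mul_assoc]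
    refine ⟨pderiv i r, ?_⟩
    rw [pderiv_mul, pderiv_pow]
    simp only [neg_add_cancel, zero_sub, map_neg, map_natCast]
    linear_combination pderiv i f * r * hk
  · intro k hk
    rw [Ideal.mem_span_singleton, pow_succ', mul_comm g, mul_comm f] at hk
    exact hfg ((mul_dvd_mul_iff_left (pow_ne_zero k hf)).mp hk)

theorem SatisfiesBS.mul_left [Fintype σ] {f g : MvPolynomial σ ℚ} {b : Polynomial ℚ}
    (hb : SatisfiesBS f g b) (c : Polynomial ℚ) : SatisfiesBS f g (c * b) := by
  obtain ⟨A, p, hp⟩ := hb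
  refine ⟨A, fun α => c.map MvPolynomial.C * p α, fun m => ?_⟩
  have hcm : (c.map MvPolynomial.C).eval (m : MvPolynomial σ ℚ) =
      MvPolynomial.C (c.eval (m : ℚ)) := by
    have := Polynomial.eval_map_apply (f := (MvPolynomial.C : ℚ →+* MvPolynomial σ ℚ))
      (p := c) (m : ℚ)
    rwa [map_natCast] at this
  simp only [Polynomial.eval_mul, hcm, mul_assoc, ← Finset.mul_sum, MvPolynomial.C_mul]
  simpa only [mul_assoc] using congrArg (MvPolynomial.C (c.eval (m : ℚ)) * ·) (hp m)

theorem pderiv_commute (i j : σ) :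
    Function.Commute (pderiv (R := ℚ) i) (pderiv (R := ℚ) j) := by
  classical
  intro p
  have h : ⁅pderiv (R := ℚ) i, pderiv (R := ℚ) j⁆ = 0 := by
    refine derivation_ext fun k => ?_
    simp [Derivation.commutator_apply, pderiv_X, Pi.single_apply, apply_ite]
  exact sub_eq_zero.mp (by simpa [Derivation.commutator_apply] using congrArg (· p) h)

end General

theorem pdIter_fin_two (α : Fin 2 → ℕ) (p : MvPolynomial (Fin 2) ℚ) :
    pdIter α p = (pderiv 1)^[α 1] ((pderiv 0)^[α 0] p) := by
  have hperm : (Finset.univ : Finset (Fin 2)).toList.Perm [0, 1] := by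
    refine (List.perm_ext_iff_of_nodup (Finset.nodup_toList _) (by simp)).mpr fun i => ?_
    fin_cases i <;> simp
  have : RightCommutative fun (q : MvPolynomial (Fin 2) ℚ) i => (⇑(pderiv i))^[α i] q :=
    ⟨fun q i j => ((pderiv_commute j i).iterate_iterate (α j) (α i)) q⟩
  exact hperm.foldl_eq p

section Cusp

/-- The moments of `x^a` under a functional killing `∂_x` of weighted homogeneous elements. -/
noncomputable def squareMoment : ℕ → ℚ
  | 0 => 1
  | 1 => 1
  | a + 2 => (a + 1) / 2 * squareMoment a

/-- The moments of `y^b` under a functional killing `∂_y` of weighted homogeneous elements. -/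
noncomputable def cubeMoment : ℕ → ℚ
  | 0 => 1
  | 1 => 1
  | 2 => 1
  | b + 3 => (b + 1) / 3 * cubeMoment b

/-- The Pochhammer symbol `(5/6 + e/3)_k`. -/
noncomputable def cuspPochhammer (e : ℕ) : ℕ → ℚ
  | 0 => 1
  | k + 1 => (k + 5 / 6 + e / 3) * cuspPochhammer e k

theorem cuspPochhammer_ne_zero (e k : ℕ) : cuspPochhammer e k ≠ 0 := by
  induction k with
  | zero => simp [cuspPochhammer]
  | succ k ih => exact mul_ne_zero (by positivity) ih

/-- The value on `x^a y^b f^(-5/6 - e/3 - k)` of a functional killing all derivatives. -/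
noncomputable def cuspMoment (e k a b : ℕ) : ℚ :=
  if 3 * a + 2 * b = 6 * k + 2 * e then squareMoment a * cubeMoment b / cuspPochhammer e k else 0

/-- The linear functional `q ↦ ∫ q f^(-5/6 - e/3 - k)`. -/
noncomputable def cuspFunctional (e k : ℕ) : MvPolynomial (Fin 2) ℚ →ₗ[ℚ] ℚ :=
  (MvPolynomial.basisMonomials (Fin 2) ℚ).constr ℚ fun d => cuspMoment e k (d 0) (d 1)

theorem monomial_fin_two (d : Fin 2 →₀ ℕ) :
    MvPolynomial.monomial d (1 : ℚ) = X 0 ^ d 0 * X 1 ^ d 1 := by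
  rw [MvPolynomial.monomial_eq, Finsupp.prod_fintype _ _ (by simp)]
  simp

theorem cuspFunctional_apply (e k a b : ℕ) :
    cuspFunctional e k (X 0 ^ a * X 1 ^ b) = cuspMoment e k a b := by
  have h := monomial_fin_two (Finsupp.single 0 a + Finsupp.single 1 b)
  simp only [Finsupp.add_apply, Finsupp.single_apply] at h
  simp only [zero_ne_one, one_ne_zero, if_true, if_false, add_zero, zero_add] at h
  have hL := (MvPolynomial.basisMonomials (Fin 2) ℚ).constr_basis ℚ
    (fun d => cuspMoment e k (d 0) (d 1)) (Finsupp.single 0 a + Finsupp.single 1 b)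
  rw [MvPolynomial.coe_basisMonomials] at hL
  rw [← h]
  simpa [cuspFunctional] using hL

theorem linearMap_fin_two_ext {M : Type*} [AddCommGroup M] [Module ℚ M]
    {L L' : MvPolynomial (Fin 2) ℚ →ₗ[ℚ] M}
    (h : ∀ a b, L (X 0 ^ a * X 1 ^ b) = L' (X 0 ^ a * X 1 ^ b)) : L = L' := by
  refine (MvPolynomial.basisMonomials (Fin 2) ℚ).ext fun d => ?_
  simpa only [MvPolynomial.coe_basisMonomials, monomial_fin_two] using h (d 0) (d 1)

theorem cuspMoment_add (e k a b : ℕ) :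
    cuspMoment e (k + 1) (a + 2) b + cuspMoment e (k + 1) a (b + 3) = cuspMoment e k a b := by
  unfold cuspMoment
  by_cases h : 3 * a + 2 * b = 6 * k + 2 * e
  · rw [if_pos (by omega), if_pos (by omega), if_pos h]
    have hq : (3 * a + 2 * b : ℚ) = 6 * k + 2 * e := by exact_mod_cast h
    have hk : (k + 5 / 6 + e / 3 : ℚ) ≠ 0 := by positivity
    have hP := cuspPochhammer_ne_zero e k
    simp only [squareMoment, cubeMoment, cuspPochhammer]
    rw [← add_div, div_eq_div_iff (mul_ne_zero hk hP) hP]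
    linear_combination squareMoment a * cubeMoment b * cuspPochhammer e k * hq / 6
  · rw [if_neg (by omega), if_neg (by omega), if_neg h, add_zero]

theorem cuspMoment_add_two (e k a b : ℕ) :
    (a + 1) * cuspMoment e k a b = 2 * (5 / 6 + e / 3 + k) * cuspMoment e (k + 1) (a + 2) b := by
  unfold cuspMoment
  by_cases h : 3 * a + 2 * b = 6 * k + 2 * e
  · rw [if_pos h, if_pos (by omega)]
    have hk : (k + 5 / 6 + e / 3 : ℚ) ≠ 0 := by positivity
    have hP := cuspPochhammer_ne_zero e k
    simp only [squareMoment, cuspPochhammer]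
    field_simp
    ring
  · rw [if_neg h, if_neg (by omega), mul_zero, mul_zero]

theorem cuspMoment_add_three (e k a b : ℕ) :
    (b + 1) * cuspMoment e k a b = 3 * (5 / 6 + e / 3 + k) * cuspMoment e (k + 1) a (b + 3) := by
  unfold cuspMoment
  by_cases h : 3 * a + 2 * b = 6 * k + 2 * e
  · rw [if_pos h, if_pos (by omega)]
    have hk : (k + 5 / 6 + e / 3 : ℚ) ≠ 0 := by positivity
    have hP := cuspPochhammer_ne_zero e k
    simp only [cubeMoment, cuspPochhammer]
    field_simp
    ring
  · rw [if_neg h, if_neg (by omega), mul_zero, mul_zero]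

theorem cuspFunctional_mul (e k : ℕ) (q : MvPolynomial (Fin 2) ℚ) :
    cuspFunctional e (k + 1) ((X 0 ^ 2 + X 1 ^ 3) * q) = cuspFunctional e k q := by
  have h : cuspFunctional e (k + 1) ∘ₗ LinearMap.mulLeft ℚ (X 0 ^ 2 + X 1 ^ 3) =
      cuspFunctional e k := by
    refine linearMap_fin_two_ext fun a b => ?_
    have hm : (X 0 ^ 2 + X 1 ^ 3 : MvPolynomial (Fin 2) ℚ) * (X 0 ^ a * X 1 ^ b) =
        X 0 ^ (a + 2) * X 1 ^ b + X 0 ^ a * X 1 ^ (b + 3) := by ring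
    rw [LinearMap.comp_apply, LinearMap.mulLeft_apply, hm, map_add]
    simp only [cuspFunctional_apply, cuspMoment_add]
  exact congrArg (· q) h

theorem cuspFunctional_pderiv_zero (e k : ℕ) (q : MvPolynomial (Fin 2) ℚ) :
    cuspFunctional e k (pderiv 0 q) =
      2 * (5 / 6 + e / 3 + k) * cuspFunctional e (k + 1) (X 0 * q) := by
  have h : cuspFunctional e k ∘ₗ (pderiv 0 : Derivation ℚ _ _).toLinearMap =
      (2 * (5 / 6 + e / 3 + k) : ℚ) • cuspFunctional e (k + 1) ∘ₗ LinearMap.mulLeft ℚ (X 0) := by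
    refine linearMap_fin_two_ext fun a b => ?_
    simp only [LinearMap.comp_apply, LinearMap.smul_apply, LinearMap.mulLeft_apply, smul_eq_mul,
      Derivation.coeFn_coe]
    rw [← mul_assoc, ← pow_succ', cuspFunctional_apply]
    cases a with
    | zero =>
      have h0 : cuspMoment e (k + 1) (0 + 1) b = 0 := if_neg (by omega)
      simp [h0, pderiv_X]
    | succ a =>
      have hd : pderiv 0 (X 0 ^ (a + 1) * X 1 ^ b : MvPolynomial (Fin 2) ℚ) =
          ((a + 1 : ℚ)) • (X 0 ^ a * X 1 ^ b) := by
        simp [pderiv_X, MvPolynomial.smul_eq_C_mul]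
        ring
      rw [hd, map_smul, cuspFunctional_apply, smul_eq_mul, cuspMoment_add_two]
  exact congrArg (· q) h

theorem cuspFunctional_pderiv_one {e : ℕ} (he : e ≤ 1) (k : ℕ) (q : MvPolynomial (Fin 2) ℚ) :
    cuspFunctional e k (pderiv 1 q) =
      3 * (5 / 6 + e / 3 + k) * cuspFunctional e (k + 1) (X 1 ^ 2 * q) := by
  have h : cuspFunctional e k ∘ₗ (pderiv 1 : Derivation ℚ _ _).toLinearMap =
      (3 * (5 / 6 + e / 3 + k) : ℚ) •
        cuspFunctional e (k + 1) ∘ₗ LinearMap.mulLeft ℚ (X 1 ^ 2) := by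
    refine linearMap_fin_two_ext fun a b => ?_
    simp only [LinearMap.comp_apply, LinearMap.smul_apply, LinearMap.mulLeft_apply, smul_eq_mul,
      Derivation.coeFn_coe]
    rw [mul_left_comm, ← pow_add, add_comm 2 b, cuspFunctional_apply]
    cases b with
    | zero =>
      have h0 : cuspMoment e (k + 1) a (0 + 2) = 0 := if_neg (by omega)
      simp [h0, pderiv_X]
    | succ b =>
      have hd : pderiv 1 (X 0 ^ a * X 1 ^ (b + 1) : MvPolynomial (Fin 2) ℚ) =
          ((b + 1 : ℚ)) • (X 0 ^ a * X 1 ^ b) := by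
        simp [pderiv_X, MvPolynomial.smul_eq_C_mul]
        ring
      rw [hd, map_smul, cuspFunctional_apply, smul_eq_mul, cuspMoment_add_three]
  exact congrArg (· q) h

theorem cuspFunctional_zero_mul_X {e : ℕ} (he : e ≤ 1) (q : MvPolynomial (Fin 2) ℚ) :
    cuspFunctional e 0 (q * X 0) = 0 := by
  have h : cuspFunctional e 0 ∘ₗ LinearMap.mulRight ℚ (X 0) = 0 := by
    refine linearMap_fin_two_ext fun a b => ?_
    rw [LinearMap.comp_apply, LinearMap.mulRight_apply, mul_right_comm, ← pow_succ,
      cuspFunctional_apply]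
    exact if_neg (by omega)
  exact congrArg (· q) h

theorem cusp_ne_zero : (X 0 ^ 2 + X 1 ^ 3 : MvPolynomial (Fin 2) ℚ) ≠ 0 := by
  intro h
  simpa using congrArg (MvPolynomial.eval ![1, 0]) h

theorem not_cusp_dvd_X : ¬ (X 0 ^ 2 + X 1 ^ 3 : MvPolynomial (Fin 2) ℚ) ∣ X 0 := by
  rintro ⟨r, hr⟩
  have h := congrArg (MvPolynomial.eval ![1, -1]) hr
  norm_num at h

theorem SatisfiesBS.eval_cusp_eq_zero {b : Polynomial ℚ}
    (hb : SatisfiesBS (X 0 ^ 2 + X 1 ^ 3 : MvPolynomial (Fin 2) ℚ) (X 0) b) {e : ℕ} (he : e ≤ 1) :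
    b.eval (-11 / 6 - e / 3 : ℚ) = 0 := by
  refine hb.eval_eq_zero_of_functional cusp_ne_zero _ (cuspFunctional e)
    (cuspFunctional_zero_mul_X he) (cuspFunctional_mul e) ?_ (X 0 * X 1 ^ e) ?_
  · intro k i q
    rw [map_add, cuspFunctional_mul, mul_assoc, ← MvPolynomial.smul_eq_C_mul, map_smul, smul_eq_mul]
    fin_cases i
    · have hd : pderiv 0 (X 0 ^ 2 + X 1 ^ 3 : MvPolynomial (Fin 2) ℚ) * q =
          (2 : ℚ) • (X 0 * q) := by
        rw [MvPolynomial.smul_eq_C_mul, map_ofNat]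
        simp [pderiv_X, mul_assoc]
      simp only [Fin.zero_eta, hd, map_smul, smul_eq_mul, cuspFunctional_pderiv_zero]
      ring
    · have hd : pderiv 1 (X 0 ^ 2 + X 1 ^ 3 : MvPolynomial (Fin 2) ℚ) * q =
          (3 : ℚ) • (X 1 ^ 2 * q) := by
        rw [MvPolynomial.smul_eq_C_mul, map_ofNat]
        simp [pderiv_X, mul_assoc]
      simp only [Fin.mk_one, hd, map_smul, smul_eq_mul, cuspFunctional_pderiv_one he]
      ring
  · have hm : (X 0 * X 1 ^ e * X 0 : MvPolynomial (Fin 2) ℚ) = X 0 ^ 2 * X 1 ^ e := by ring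
    rw [hm, cuspFunctional_apply, cuspMoment, if_pos (by omega)]
    refine div_ne_zero (mul_ne_zero (by norm_num [squareMoment]) ?_) (cuspPochhammer_ne_zero e 1)
    interval_cases e <;> simp [cubeMoment]

/-- The functional equation is witnessed by the operator
`∂_x²/2 + ∂_y³/27 + y ∂_x² ∂_y/6 + x ∂_x³/8`. -/
theorem satisfiesBS_cusp :
    SatisfiesBS (X 0 ^ 2 + X 1 ^ 3 : MvPolynomial (Fin 2) ℚ) (X 0)
      ((Polynomial.X + Polynomial.C (1 : ℚ)) * (Polynomial.X + Polynomial.C (11 / 6 : ℚ)) *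
        (Polynomial.X + Polynomial.C (13 / 6 : ℚ))) := by
  set h : MvPolynomial (Fin 2) ℚ := MvPolynomial.C (1 / 216)
  refine ⟨{![2, 0], ![0, 3], ![2, 1], ![3, 0]}, fun α => Polynomial.C (h *
    if α = ![2, 0] then 108 else if α = ![0, 3] then 8 else if α = ![2, 1] then 36 * X 1
      else 27 * X 0), fun m => ?_⟩
  have hb : MvPolynomial.C (Polynomial.eval (m : ℚ) ((Polynomial.X + Polynomial.C (1 : ℚ)) *
      (Polynomial.X + Polynomial.C (11 / 6 : ℚ)) * (Polynomial.X + Polynomial.C (13 / 6 : ℚ)))) =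
      h * ((6 * (m + 1) * (6 * m + 11) * (6 * m + 13) : ℕ) : MvPolynomial (Fin 2) ℚ) := by
    have hq : Polynomial.eval (m : ℚ) ((Polynomial.X + Polynomial.C (1 : ℚ)) *
        (Polynomial.X + Polynomial.C (11 / 6 : ℚ)) * (Polynomial.X + Polynomial.C (13 / 6 : ℚ))) =
        1 / 216 * ((6 * (m + 1) * (6 * m + 11) * (6 * m + 13) : ℕ) : ℚ) := by
      simp
      ring
    rw [hq, MvPolynomial.C_mul, map_natCast]
  rw [hb, Finset.sum_insert (by decide), Finset.sum_insert (by decide),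
    Finset.sum_insert (by decide), Finset.sum_singleton]
  have h1 : (![0, 3] : Fin 2 → ℕ) ≠ ![2, 0] := by decide
  have h2 : (![2, 1] : Fin 2 → ℕ) ≠ ![2, 0] := by decide
  have h3 : (![2, 1] : Fin 2 → ℕ) ≠ ![0, 3] := by decide
  have h4 : (![3, 0] : Fin 2 → ℕ) ≠ ![2, 0] := by decide
  have h5 : (![3, 0] : Fin 2 → ℕ) ≠ ![0, 3] := by decide
  have h6 : (![3, 0] : Fin 2 → ℕ) ≠ ![2, 1] := by decide
  simp only [if_neg h1, if_neg h2, if_neg h3, if_neg h4, if_neg h5, if_neg h6, if_true,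
    Polynomial.eval_C, pdIter_fin_two, Matrix.cons_val_zero, Matrix.cons_val_one,
    Function.iterate_succ, Function.iterate_zero, Function.comp_apply, id]
  have hofNat : ∀ (i : Fin 2) (n : ℕ) [n.AtLeastTwo],
      pderiv i (OfNat.ofNat n : MvPolynomial (Fin 2) ℚ) = 0 := fun i n _ => by
    rw [← map_ofNat MvPolynomial.C n, pderiv_C]
  clear_value h
  push_cast
  rcases m with _ | _ | m
  · simp [pderiv_X, hofNat]
    ring
  · simp [pderiv_X, hofNat]
    ring
  · simp [pderiv_X, hofNat]
    ring

end Cusp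

theorem bernsteinSato_stmt_6 :
    ∀ b : Polynomial ℚ,
      SatisfiesBS ((X 0) ^ 2 + (X 1) ^ 3 : MvPolynomial (Fin 2) ℚ)
          (X 0) b ↔
        (Polynomial.X + Polynomial.C (1 : ℚ)) *
            (Polynomial.X + Polynomial.C (11 / 6 : ℚ)) *
            (Polynomial.X + Polynomial.C (13 / 6 : ℚ)) ∣ b := by
  intro b
  constructor
  · intro hb
    have hX : ∀ a : ℚ, Polynomial.X + Polynomial.C a = Polynomial.X - Polynomial.C (-a) := by
      simp
    have h1 := hb.eval_neg_one_eq_zero cusp_ne_zero not_cusp_dvd_X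
    have h2 := hb.eval_cusp_eq_zero (e := 0) zero_le_one
    have h3 := hb.eval_cusp_eq_zero (e := 1) le_rfl
    norm_num at h2 h3
    have hcop : ∀ {a c : ℚ}, a ≠ c →
        IsCoprime (Polynomial.X - Polynomial.C a) (Polynomial.X - Polynomial.C c) := fun hac =>
      Polynomial.isCoprime_X_sub_C_of_isUnit_sub (sub_ne_zero.mpr hac).isUnit
    simp only [hX]
    refine IsCoprime.mul_dvd (IsCoprime.mul_left (hcop (by norm_num)) (hcop (by norm_num)))
      (IsCoprime.mul_dvd (hcop (by norm_num)) ?_ ?_) ?_ <;> rw [Polynomial.dvd_iff_isRoot]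
    · exact h1
    · exact h2
    · exact h3
  · rintro ⟨c, rfl⟩
    rw [mul_comm]
    exact satisfiesBS_cusp.mul_left c
end
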